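/- arXiv:1809.03678 — 3 statements merged into one kernel-verified Lean document; each statement's English description precedes it below -/
import Mathlib

section
/- Let (Γ,α) be an orbifold torus graph admitting a connection θ, and let F be any face of (Γ,α). Then the rational Thom class τ_F belongs to H*_T(Γ,α;ℚ); that is, for every oriented edge e of Γ, the difference τ_F(i(e)) − τ_F(t(e)) is divisible by the linear form α(e) in ℚ[t_1,…,t_n]. -/
open scoped Classical

noncomputable section

/-- A finite graph with oriented edges: orientation reversal `bar`, initial vertex `src`
(denoted `i(e)` in the paper) and terminal vertex `dst` (denoted `t(e)`). -/
structure OTGraph (V E : Type) where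
  bar : E → E
  src : E → V
  dst : E → V
  bar_bar : ∀ e, bar (bar e) = e
  src_bar : ∀ e, src (bar e) = dst e
  dst_bar : ∀ e, dst (bar e) = src e

namespace OT

variable {V E : Type}

/-- The graph is `n`-valent: every vertex has exactly `n` outgoing edges. -/
def IsValent (G : OTGraph V E) (n : ℕ) : Prop :=
  ∀ v : V, Nat.card {e : E // G.src e = v} = n

/-- A rational vector has integer entries. -/
def IsIntVec {n : ℕ} (a : Fin n → ℚ) : Prop := ∀ j, ∃ z : ℤ, a j = (z : ℚ)

/-- The axial-function conditions for an orbifold torus graph / orbifold GKM-graph: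
(1) the vectors attached to the outgoing edges at each vertex are linearly independent;
(2) for each edge `e` there are positive integers `r_e`, `r_ē` with
`r_e • α e = ± r_ē • α (ē)` an integer vector. -/
def IsAxial {n : ℕ} (G : OTGraph V E) (α : E → Fin n → ℚ) : Prop :=
  (∀ p : V, LinearIndependent ℚ (fun e : {e : E // G.src e = p} => α e.1)) ∧
  (∀ e : E, ∃ r r' : ℕ, 0 < r ∧ 0 < r' ∧ IsIntVec ((r : ℚ) • α e) ∧
    ((r : ℚ) • α e = (r' : ℚ) • α (G.bar e) ∨ (r : ℚ) • α e = -((r' : ℚ) • α (G.bar e))))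

/-- `r̃_e` : the smallest positive integer `m` with `m • α e ∈ ℤ^n`. -/
def rtil {n : ℕ} (α : E → Fin n → ℚ) (e : E) : ℕ :=
  sInf {m : ℕ | 0 < m ∧ IsIntVec ((m : ℚ) • α e)}

/-- A connection on an (orbifold) torus graph: for each oriented edge `e`, a bijection
`θ e` from the outgoing edges at `i(e)` to the outgoing edges at `t(e)` with `θ e e = ē`,
such that for each outgoing edge `e'` at `i(e)` there is a nonzero integer `c` with
`c • (α (θ e e') - α e')` an integer multiple of `r̃_e • α e`. -/
def IsConnection {n : ℕ} (G : OTGraph V E) (α : E → Fin n → ℚ) (θ : E → E → E) : Prop :=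
  (∀ e : E, Set.BijOn (θ e) {e' | G.src e' = G.src e} {e' | G.src e' = G.dst e}) ∧
  (∀ e : E, θ e e = G.bar e) ∧
  (∀ e e' : E, G.src e' = G.src e →
    ∃ c : ℤ, c ≠ 0 ∧ ∃ z : ℤ,
      (c : ℚ) • (α (θ e e') - α e') = ((z * (rtil α e : ℤ) : ℤ) : ℚ) • α e)

/-- A subgraph: a set of vertices together with a set of oriented edges. -/
structure Subgr (V E : Type) where
  verts : Set V
  edges : Set E

/-- Containment of subgraphs. -/
def Subgr.le (A B : Subgr V E) : Prop := A.verts ⊆ B.verts ∧ A.edges ⊆ B.edges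

/-- Reachability inside a subgraph. -/
def Reach (G : OTGraph V E) (S : Subgr V E) : V → V → Prop :=
  Relation.ReflTransGen (fun u w => ∃ e ∈ S.edges, G.src e = u ∧ G.dst e = w)

/-- A face of the (orbifold) torus graph: a nonempty connected `d`-valent subgraph, closed
under orientation reversal, which is invariant under the connection `θ`. -/
def IsFace (G : OTGraph V E) (θ : E → E → E) (S : Subgr V E) : Prop :=
  S.verts.Nonempty ∧
  (∀ e ∈ S.edges, G.src e ∈ S.verts ∧ G.dst e ∈ S.verts) ∧
  (∀ e ∈ S.edges, G.bar e ∈ S.edges) ∧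
  (∃ d : ℕ, ∀ v ∈ S.verts, Nat.card {e : E // e ∈ S.edges ∧ G.src e = v} = d) ∧
  (∀ u ∈ S.verts, ∀ w ∈ S.verts, Reach G S u w) ∧
  (∀ e ∈ S.edges, ∀ e', G.src e' = G.src e → e' ∈ S.edges → θ e e' ∈ S.edges)

/-- Proper faces: faces other than the whole graph `Γ`.  These index the generators
`x_F` of the (weighted) face ring; the convention `x_Γ = 1` is built into `xpoly`. -/
def PFace (G : OTGraph V E) (θ : E → E → E) : Type :=
  {S : Subgr V E // IsFace G θ S ∧ S.edges ≠ Set.univ}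

/-- The generator `x_F` attached to a subgraph: `x_Γ = 1`, `x_F = X F` for a proper face,
and `0` if `F` is not a face (the convention `x_∅ = 0`). -/
def xpoly (G : OTGraph V E) (θ : E → E → E) (S : Subgr V E) :
    MvPolynomial (PFace G θ) ℚ :=
  if h : IsFace G θ S then
    (if htop : S.edges = Set.univ then 1 else MvPolynomial.X (⟨S, h, htop⟩ : PFace G θ))
  else 0

/-- The linear form in `ℚ[t_1,…,t_n]` associated to a vector `a ∈ ℚ^n`. -/
def linf {n : ℕ} (a : Fin n → ℚ) : MvPolynomial (Fin n) ℚ :=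
  ∑ j, MvPolynomial.C (a j) * MvPolynomial.X j

/-- The rational Thom class `τ_F` of a subgraph `F`. -/
def tau {n : ℕ} (G : OTGraph V E) (α : E → Fin n → ℚ) (S : Subgr V E) (v : V) :
    MvPolynomial (Fin n) ℚ :=
  if v ∈ S.verts then ∏ᶠ (e : E) (_ : G.src e = v ∧ e ∉ S.edges), linf (α e) else 0

/-- The ring homomorphism `μ : ℚ[x_F | F ∈ 𝓕] → Maps(V(Γ), ℚ[t_1,…,t_n])`, `x_F ↦ τ_F`. -/
def mu {n : ℕ} (G : OTGraph V E) (α : E → Fin n → ℚ) (θ : E → E → E) :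
    MvPolynomial (PFace G θ) ℚ →+* (V → MvPolynomial (Fin n) ℚ) :=
  MvPolynomial.eval₂Hom ((Pi.constRingHom V (MvPolynomial (Fin n) ℚ)).comp MvPolynomial.C)
    (fun F => tau G α F.1)

/-- A polynomial with rational coefficients has integer coefficients. -/
def IsIntPoly {σ : Type} (p : MvPolynomial σ ℚ) : Prop :=
  ∀ m : σ →₀ ℕ, ∃ z : ℤ, MvPolynomial.coeff m p = (z : ℚ)

/-- `𝒵_{Γ,α}`: integer-coefficient polynomials in the `x_F` all of whose `μ`-values
at vertices are integer-coefficient polynomials. -/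
def Zset {n : ℕ} (G : OTGraph V E) (α : E → Fin n → ℚ) (θ : E → E → E) :
    Set (MvPolynomial (PFace G θ) ℚ) :=
  {f | IsIntPoly f ∧ ∀ v : V, IsIntPoly (mu G α θ f v)}

/-- The integral equivariant cohomology `H^*_T(Γ,α)` of the graph. -/
def HintSet {n : ℕ} (G : OTGraph V E) (α : E → Fin n → ℚ) :
    Set (V → MvPolynomial (Fin n) ℚ) :=
  {f | (∀ v, IsIntPoly (f v)) ∧
    ∀ e : E, ∃ g : MvPolynomial (Fin n) ℚ, IsIntPoly g ∧
      f (G.src e) - f (G.dst e) = linf ((rtil α e : ℚ) • α e) * g}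

/-- The rational equivariant cohomology `H^*_T(Γ,α;ℚ)` of the graph. -/
def HQSet {n : ℕ} (G : OTGraph V E) (α : E → Fin n → ℚ) :
    Set (V → MvPolynomial (Fin n) ℚ) :=
  {f | ∀ e : E, linf (α e) ∣ (f (G.src e) - f (G.dst e))}

/-- Intersection of subgraphs. -/
def Subgr.inter (A B : Subgr V E) : Subgr V E := ⟨A.verts ∩ B.verts, A.edges ∩ B.edges⟩

/-- `C` is a connected component of the subgraph `S`. -/
def IsCompOf (G : OTGraph V E) (C S : Subgr V E) : Prop :=
  ∃ v₀ ∈ S.verts, C.verts = {w ∈ S.verts | Reach G S v₀ w} ∧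
    C.edges = {e ∈ S.edges | G.src e ∈ C.verts ∧ G.dst e ∈ C.verts}

/-- The relation `x_A x_B − x_{A∨B} Σ_C x_C`, the sum over connected components of `A ∩ B`. -/
def relPoly (G : OTGraph V E) (θ : E → E → E)
    (join : Subgr V E → Subgr V E → Subgr V E) (A B : Subgr V E) :
    MvPolynomial (PFace G θ) ℚ :=
  xpoly G θ A * xpoly G θ B -
    xpoly G θ (join A B) *
      ∑ᶠ (C : Subgr V E) (_ : IsCompOf G C (Subgr.inter A B)), xpoly G θ C

/-- The set of all relations `x_A x_B − x_{A∨B} Σ_C x_C`, over pairs of faces `A`,`B`. -/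
def relSet (G : OTGraph V E) (θ : E → E → E)
    (join : Subgr V E → Subgr V E → Subgr V E) :
    Set (MvPolynomial (PFace G θ) ℚ) :=
  {p | ∃ A B : Subgr V E, IsFace G θ A ∧ IsFace G θ B ∧ p = relPoly G θ join A B}

/-- Membership in the ideal `ℐ` of `𝒵_{Γ,α}` generated by the relations. -/
def memI {n : ℕ} (G : OTGraph V E) (α : E → Fin n → ℚ) (θ : E → E → E)
    (join : Subgr V E → Subgr V E → Subgr V E)
    (f : MvPolynomial (PFace G θ) ℚ) : Prop :=
  ∃ (k : ℕ) (g r : Fin k → MvPolynomial (PFace G θ) ℚ),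
    (∀ i, g i ∈ Zset G α θ ∧ r i ∈ relSet G θ join) ∧ f = ∑ i, g i * r i

/-- `join` assigns to every pair of faces a minimal face containing both. -/
def IsJoinFun (G : OTGraph V E) (θ : E → E → E)
    (join : Subgr V E → Subgr V E → Subgr V E) : Prop :=
  ∀ A B : Subgr V E, IsFace G θ A → IsFace G θ B →
    IsFace G θ (join A B) ∧ Subgr.le A (join A B) ∧ Subgr.le B (join A B) ∧
    ∀ C : Subgr V E, IsFace G θ C → Subgr.le A C → Subgr.le B C → Subgr.le (join A B) C

end OT

namespace OT

variable {V E : Type}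

theorem linf_add {n : ℕ} (a b : Fin n → ℚ) : linf (a + b) = linf a + linf b := by
  simp [linf, add_mul, Finset.sum_add_distrib]

theorem linf_smul {n : ℕ} (c : ℚ) (a : Fin n → ℚ) :
    linf (c • a) = MvPolynomial.C c * linf a := by
  simp [linf, Finset.mul_sum, mul_assoc]

theorem linf_dvd_linf_smul {n : ℕ} (c : ℚ) (a : Fin n → ℚ) : linf a ∣ linf (c • a) :=
  ⟨MvPolynomial.C c, by rw [linf_smul, mul_comm]⟩

theorem linf_dvd_linf_bar {n : ℕ} {G : OTGraph V E} {α : E → Fin n → ℚ} (hax : IsAxial G α)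
    (e : E) : linf (α e) ∣ linf (α (G.bar e)) := by
  obtain ⟨r, r', -, hr', -, h⟩ := hax.2 e
  have hr : (r' : ℚ) ≠ 0 := by positivity
  obtain ⟨c, hc⟩ : ∃ c : ℚ, α (G.bar e) = c • α e := by
    rcases h with h | h
    · exact ⟨(r' : ℚ)⁻¹ * r, by rw [mul_smul, h, inv_smul_smul₀ hr]⟩
    · exact ⟨-((r' : ℚ)⁻¹ * r), by rw [neg_smul, mul_smul, h, smul_neg, inv_smul_smul₀ hr, neg_neg]⟩
  rw [hc]
  exact linf_dvd_linf_smul c _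

theorem IsConnection.linf_dvd_sub {n : ℕ} {G : OTGraph V E} {α : E → Fin n → ℚ}
    {θ : E → E → E} (hθ : IsConnection G α θ) {e e' : E} (h : G.src e' = G.src e) :
    linf (α e) ∣ linf (α e') - linf (α (θ e e')) := by
  obtain ⟨c, hc, z, hz⟩ := hθ.2.2 e e' h
  have hc' : (c : ℚ) ≠ 0 := by exact_mod_cast hc
  have key : α (θ e e') = α e' + ((c : ℚ)⁻¹ * ((z * (rtil α e : ℤ) : ℤ) : ℚ)) • α e := by
    rw [mul_smul, ← hz, inv_smul_smul₀ hc', add_sub_cancel]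
  rw [key, linf_add, sub_add_cancel_left, dvd_neg]
  exact linf_dvd_linf_smul _ _

/-- If an edge leaves `F` at a vertex, its linear form divides the Thom class there. -/
theorem linf_dvd_tau [Finite E] {n : ℕ} (G : OTGraph V E) (α : E → Fin n → ℚ)
    (F : Subgr V E) {e : E} (he : e ∉ F.edges) : linf (α e) ∣ tau G α F (G.src e) := by
  unfold tau
  split_ifs
  · change _ ∣ ∏ᶠ e' ∈ {e' | G.src e' = G.src e ∧ e' ∉ F.edges}, linf (α e')
    rw [finprod_mem_eq_finite_toFinset_prod _ (Set.toFinite _)]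
    exact Finset.dvd_prod_of_mem (fun e' => linf (α e'))
      ((Set.Finite.mem_toFinset _).2 ⟨rfl, he⟩)
  · exact dvd_zero _

/-- Along an edge of a face, the connection matches the edges normal to the face. -/
theorem IsFace.bijOn_normal [Finite E] {n : ℕ} {G : OTGraph V E} {α : E → Fin n → ℚ}
    {θ : E → E → E} (hθ : IsConnection G α θ) {F : Subgr V E} (hF : IsFace G θ F)
    {e : E} (he : e ∈ F.edges) :
    Set.BijOn (θ e) {e' | G.src e' = G.src e ∧ e' ∉ F.edges}
      {e' | G.src e' = G.dst e ∧ e' ∉ F.edges} := by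
  obtain ⟨-, hends, -, ⟨d, hd⟩, -, hinv⟩ := hF
  obtain ⟨hmaps, hinj, hsurj⟩ := hθ.1 e
  set A : Set E := {e' | e' ∈ F.edges ∧ G.src e' = G.src e}
  set B : Set E := {e' | e' ∈ F.edges ∧ G.src e' = G.dst e}
  have hAinj : Set.InjOn (θ e) A := hinj.mono fun _ h => h.2
  have himage : θ e '' A = B := by
    refine Set.eq_of_subset_of_ncard_le ?_ ?_ (Set.toFinite _)
    · rintro _ ⟨x, hx, rfl⟩
      exact ⟨hinv e he x hx.2 hx.1, hmaps hx.2⟩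
    · rw [hAinj.ncard_image]
      exact ((hd _ (hends e he).2).trans (hd _ (hends e he).1).symm).le
  refine ⟨fun x hx => ⟨hmaps hx.1, fun hxF => ?_⟩, hinj.mono fun _ h => h.1, fun y hy => ?_⟩
  · obtain ⟨a, ha, hax⟩ : θ e x ∈ θ e '' A := himage ▸ ⟨hxF, hmaps hx.1⟩
    exact hx.2 (hinj ha.2 hx.1 hax ▸ ha.1)
  · obtain ⟨x, hx, rfl⟩ := hsurj hy.1
    exact ⟨x, ⟨hx, fun hxF => hy.2 (hinv e he x hx hxF)⟩, rfl⟩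

end OT

open OT in
/-- the rational Thom class `τ_F` of any face `F` belongs to
`H^*_T(Γ,α;ℚ)`: for every oriented edge `e`, `α(e)` divides `τ_F(i(e)) − τ_F(t(e))`. -/
theorem thom_class_mem_rational_equivariant_cohomology
    {V E : Type} [Fintype V] [Fintype E] {n : ℕ} (hn : 1 ≤ n)
    (G : OTGraph V E) (hval : IsValent G n)
    (α : E → Fin n → ℚ) (hax : IsAxial G α)
    (θ : E → E → E) (hθ : IsConnection G α θ)
    (F : Subgr V E) (hF : IsFace G θ F) :
    ∀ e : E, linf (α e) ∣ (tau G α F (G.src e) - tau G α F (G.dst e)) := by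
  intro e
  by_cases he : e ∈ F.edges
  · have hends := hF.2.1 e he
    rw [tau, tau, if_pos hends.1, if_pos hends.2, ← Ideal.mem_span_singleton,
      ← Ideal.Quotient.mk_eq_mk_iff_sub_mem]
    let q := (Ideal.Quotient.mk (Ideal.span {linf (α e)})).toMonoidHom
    change q (∏ᶠ e' ∈ {e' | G.src e' = G.src e ∧ e' ∉ F.edges}, linf (α e')) =
      q (∏ᶠ e' ∈ {e' | G.src e' = G.dst e ∧ e' ∉ F.edges}, linf (α e'))
    rw [q.map_finprod_mem _ (Set.toFinite _), q.map_finprod_mem _ (Set.toFinite _)]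
    refine finprod_mem_eq_of_bijOn (θ e) (hF.bijOn_normal hθ he) fun x hx => ?_
    exact Ideal.Quotient.mk_eq_mk_iff_sub_mem _ _ |>.2
      (Ideal.mem_span_singleton.2 (hθ.linf_dvd_sub hx.1))
  · have hbar : G.bar e ∉ F.edges := fun h => he (G.bar_bar e ▸ hF.2.2.1 _ h)
    refine dvd_sub (linf_dvd_tau G α F he) ?_
    rw [← G.src_bar]
    exact (linf_dvd_linf_bar hax e).trans (linf_dvd_tau G α F hbar)
end
end

section
/- Let (Γ,α) be an orbifold torus graph admitting a connection, and let E and F be faces such that a minimal face E∨F containing both exists and every connected component of E∩F is a face. Then the rational Thom classes satisfy the relation τ_E·τ_F = τ_{E∨F}·Σ_G τ_G as functions V(Γ) → ℚ[t_1,…,t_n], where G runs over the connected components of E∩F (the right-hand side being 0 if E∩F is empty or no face contains both E and F). -/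
open scoped Classical

noncomputable section

namespace OT

variable {V E : Type}

/-- Reachability is symmetric in a subgraph closed under orientation reversal. -/
theorem Reach.symm {G : OTGraph V E} {S : Subgr V E} (hS : ∀ e ∈ S.edges, G.bar e ∈ S.edges)
    {u w : V} (h : Reach G S u w) : Reach G S w u := by
  induction h with
  | refl => exact Relation.ReflTransGen.refl
  | tail _ hstep ih =>
    obtain ⟨e, he, rfl, rfl⟩ := hstep
    exact Relation.ReflTransGen.head ⟨G.bar e, hS e he, G.src_bar e, G.dst_bar e⟩ ih

/-- Reachability is monotone in the edge set. -/
theorem Reach.mono {G : OTGraph V E} {S T : Subgr V E} (h : S.edges ⊆ T.edges) {u w : V}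
    (hr : Reach G S u w) : Reach G T u w :=
  Relation.ReflTransGen.mono (fun _ _ ⟨e, he, h'⟩ => ⟨e, h he, h'⟩) _ _ hr

/-- The axial vectors of `e` and of its reversal lie in the same subspaces. -/
theorem IsAxial.bar_mem {n : ℕ} {G : OTGraph V E} {α : E → Fin n → ℚ} (hax : IsAxial G α)
    {W : Submodule ℚ (Fin n → ℚ)} {e : E} (he : α e ∈ W) : α (G.bar e) ∈ W := by
  obtain ⟨r, r', -, hr', -, h⟩ := hax.2 e
  have hr0 : (r' : ℚ) ≠ 0 := by exact_mod_cast hr'.ne'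
  rw [← W.smul_mem_iff hr0]
  rcases h with h | h
  · exact h ▸ W.smul_mem _ he
  · rw [← W.neg_mem_iff, ← h]
    exact W.smul_mem _ he

/-- Transport along an edge whose axial vector lies in `W` preserves membership in `W`. -/
theorem IsConnection.mem_iff {n : ℕ} {G : OTGraph V E} {α : E → Fin n → ℚ} {θ : E → E → E}
    (hθ : IsConnection G α θ) {W : Submodule ℚ (Fin n → ℚ)} {e e' : E} (he : α e ∈ W)
    (hs : G.src e' = G.src e) : α (θ e e') ∈ W ↔ α e' ∈ W := by
  obtain ⟨c, hc, z, h⟩ := hθ.2.2 e e' hs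
  have hc0 : (c : ℚ) ≠ 0 := by exact_mod_cast hc
  have hsub : α (θ e e') - α e' ∈ W := by
    rw [← W.smul_mem_iff hc0, h]
    exact W.smul_mem _ he
  constructor <;> intro hm
  · simpa using W.sub_mem hm hsub
  · simpa using W.add_mem hsub hm

/-- The connected component of `v` in the subgraph of edges with axial vector in `W`. -/
def spanFace {n : ℕ} (G : OTGraph V E) (α : E → Fin n → ℚ) (W : Submodule ℚ (Fin n → ℚ))
    (v : V) : Subgr V E where
  verts := {w | Reach G ⟨Set.univ, {e | α e ∈ W}⟩ v w}
  edges := {e | α e ∈ W ∧ Reach G ⟨Set.univ, {e | α e ∈ W}⟩ v (G.src e)}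

theorem reach_spanFace {n : ℕ} {G : OTGraph V E} {α : E → Fin n → ℚ}
    {W : Submodule ℚ (Fin n → ℚ)} {v w : V}
    (h : Reach G ⟨Set.univ, {e | α e ∈ W}⟩ v w) : Reach G (spanFace G α W v) v w := by
  induction h with
  | refl => exact Relation.ReflTransGen.refl
  | tail hr hstep ih =>
    obtain ⟨e, he, rfl, rfl⟩ := hstep
    exact ih.tail ⟨e, ⟨he, hr⟩, rfl, rfl⟩

theorem isFace_spanFace {n : ℕ} {G : OTGraph V E} {α : E → Fin n → ℚ} (hax : IsAxial G α)
    {θ : E → E → E} (hθ : IsConnection G α θ) (W : Submodule ℚ (Fin n → ℚ)) (v : V) :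
    IsFace G θ (spanFace G α W v) := by
  have hdst : ∀ e ∈ (spanFace G α W v).edges, G.dst e ∈ (spanFace G α W v).verts :=
    fun e he => Relation.ReflTransGen.tail he.2 ⟨e, he.1, rfl, rfl⟩
  have hbar : ∀ e ∈ (spanFace G α W v).edges, G.bar e ∈ (spanFace G α W v).edges := by
    intro e he
    refine ⟨hax.bar_mem he.1, ?_⟩
    rw [G.src_bar]
    exact hdst e he
  refine ⟨⟨v, Relation.ReflTransGen.refl⟩, fun e he => ⟨he.2, hdst e he⟩, hbar,
    ⟨Nat.card {e : E // e ∈ (spanFace G α W v).edges ∧ G.src e = v}, fun w hw => ?_⟩,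
    fun u hu w hw => (Reach.symm hbar (reach_spanFace hu)).trans (reach_spanFace hw),
    fun e he e' hs he' => ⟨(hθ.mem_iff he.1 hs).2 he'.1, ?_⟩⟩
  · have hw' : Reach G (spanFace G α W v) v w := reach_spanFace hw
    clear hw
    induction hw' with
    | refl => rfl
    | tail _ hstep ih =>
      obtain ⟨e, he, rfl, rfl⟩ := hstep
      rw [← ih]
      symm
      change Set.ncard {e' | e' ∈ (spanFace G α W v).edges ∧ G.src e' = G.src e} =
        Set.ncard {e' | e' ∈ (spanFace G α W v).edges ∧ G.src e' = G.dst e}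
      have hbij := hθ.1 e
      refine Set.BijOn.ncard_eq (f := θ e) ⟨?_, hbij.injOn.mono fun _ h => h.2, ?_⟩
      · intro e' he'
        have hs := hbij.mapsTo he'.2
        refine ⟨⟨(hθ.mem_iff he.1 he'.2).2 he'.1.1, ?_⟩, hs⟩
        rw [show G.src (θ e e') = G.dst e from hs]
        exact hdst e he
      · intro f hf
        obtain ⟨e', hs, rfl⟩ := hbij.surjOn hf.2
        refine ⟨e', ⟨⟨(hθ.mem_iff he.1 hs).1 hf.1.1, ?_⟩, hs⟩, rfl⟩
        rw [show G.src e' = G.src e from hs]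
        exact he.2
  · rw [show G.src (θ e e') = G.dst e from (hθ.1 e).mapsTo hs]
    exact hdst e he

/-- A face through `v` is contained in `spanFace G α W v` as soon as its edges at `v` have
axial vectors in `W`. -/
theorem IsFace.le_spanFace [Finite E] {n : ℕ} {G : OTGraph V E} {α : E → Fin n → ℚ}
    {θ : E → E → E} (hθ : IsConnection G α θ) {S : Subgr V E} (hS : IsFace G θ S)
    {W : Submodule ℚ (Fin n → ℚ)} {v : V} (hv : v ∈ S.verts)
    (hW : ∀ e ∈ S.edges, G.src e = v → α e ∈ W) : S.le (spanFace G α W v) := by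
  obtain ⟨-, hends, -, ⟨d, hd⟩, hconn, hinv⟩ := hS
  have hall : ∀ w, Reach G S v w → ∀ e ∈ S.edges, G.src e = w → α e ∈ W := by
    intro w hw
    induction hw with
    | refl => exact hW
    | tail _ hstep ih =>
      obtain ⟨e, he, rfl, rfl⟩ := hstep
      have hcard : ∀ w ∈ S.verts, Set.ncard {e' | e' ∈ S.edges ∧ G.src e' = w} = d := hd
      have himage : θ e '' {e' | e' ∈ S.edges ∧ G.src e' = G.src e} =
          {e' | e' ∈ S.edges ∧ G.src e' = G.dst e} := by
        apply Set.eq_of_subset_of_ncard_le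
        · rintro _ ⟨e', he', rfl⟩
          exact ⟨hinv e he e' he'.2 he'.1, (hθ.1 e).mapsTo he'.2⟩
        · rw [((hθ.1 e).injOn.mono fun _ h => h.2).ncard_image,
            hcard _ (hends e he).1, hcard _ (hends e he).2]
        · exact Set.toFinite _
      intro f hf hs
      obtain ⟨e', he', rfl⟩ := himage.superset ⟨hf, hs⟩
      exact (hθ.mem_iff (ih e he rfl) he'.2).2 (ih e' he'.1 he'.2)
  have hreach : ∀ w ∈ S.verts, Reach G ⟨Set.univ, {e | α e ∈ W}⟩ v w := fun w hw =>
    Reach.mono (fun e he => hall _ (hconn v hv _ (hends e he).1) e he rfl) (hconn v hv w hw)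
  exact ⟨hreach, fun e he =>
    ⟨hall _ (hconn v hv _ (hends e he).1) e he rfl, hreach _ (hends e he).1⟩⟩

/-- At a common vertex of two faces, their join has no edges besides those of the two faces. -/
theorem mem_edges_join_iff [Finite E] {n : ℕ} {G : OTGraph V E} {α : E → Fin n → ℚ}
    (hax : IsAxial G α) {θ : E → E → E} (hθ : IsConnection G α θ) {A B J : Subgr V E}
    (hA : IsFace G θ A) (hB : IsFace G θ B) (hAJ : A.le J) (hBJ : B.le J)
    (hmin : ∀ C : Subgr V E, IsFace G θ C → A.le C → B.le C → J.le C)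
    {e : E} (heA : G.src e ∈ A.verts) (heB : G.src e ∈ B.verts) :
    e ∈ J.edges ↔ e ∈ A.edges ∨ e ∈ B.edges := by
  refine ⟨fun he => ?_, fun h => h.elim (fun h => hAJ.2 h) (fun h => hBJ.2 h)⟩
  let s : Set {f : E // G.src f = G.src e} := {f | f.1 ∈ A.edges ∨ f.1 ∈ B.edges}
  let W : Submodule ℚ (Fin n → ℚ) := Submodule.span ℚ ((fun f => α f.1) '' s)
  have hmem : ∀ f : E, G.src f = G.src e → (f ∈ A.edges ∨ f ∈ B.edges) → α f ∈ W :=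
    fun f hs hf => Submodule.subset_span ⟨⟨f, hs⟩, hf, rfl⟩
  have hle := hmin _ (isFace_spanFace hax hθ W (G.src e))
    (hA.le_spanFace hθ heA fun f hf hs => hmem f hs (Or.inl hf))
    (hB.le_spanFace hθ heB fun f hf hs => hmem f hs (Or.inr hf))
  by_contra hne
  exact (hax.1 (G.src e)).notMem_span_image (s := s) (x := ⟨e, rfl⟩) hne (hle.2 he).1

/-- The connected component of `v` in a subgraph. -/
def compOf (G : OTGraph V E) (S : Subgr V E) (v : V) : Subgr V E where
  verts := {w ∈ S.verts | Reach G S v w}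
  edges := {e ∈ S.edges | (G.src e ∈ S.verts ∧ Reach G S v (G.src e)) ∧
    (G.dst e ∈ S.verts ∧ Reach G S v (G.dst e))}

theorem isCompOf_iff {G : OTGraph V E} {C S : Subgr V E} :
    IsCompOf G C S ↔ ∃ v ∈ S.verts, C = compOf G S v := by
  constructor
  · rintro ⟨v, hv, hV, hE⟩
    refine ⟨v, hv, ?_⟩
    cases C
    simp only at hV hE
    subst hV hE
    rfl
  · rintro ⟨v, hv, rfl⟩
    exact ⟨v, hv, rfl, rfl⟩

theorem compOf_eq_of_mem {G : OTGraph V E} {S : Subgr V E}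
    (hS : ∀ e ∈ S.edges, G.bar e ∈ S.edges) {v w : V} (h : w ∈ (compOf G S v).verts) :
    compOf G S v = compOf G S w := by
  have hiff : ∀ u, Reach G S v u ↔ Reach G S w u :=
    fun u => ⟨(Reach.symm hS h.2).trans, h.2.trans⟩
  simp only [compOf, hiff]

/-- Only the component through `v` contributes to the sum of the Thom classes at `v`. -/
theorem finsum_tau_comp {n : ℕ} {G : OTGraph V E} (α : E → Fin n → ℚ) {S : Subgr V E}
    (hbar : ∀ e ∈ S.edges, G.bar e ∈ S.edges)
    (hdst : ∀ e ∈ S.edges, G.dst e ∈ S.verts) (v : V) :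
    ∑ᶠ (C : Subgr V E) (_ : IsCompOf G C S), tau G α C v = tau G α S v := by
  by_cases hv : v ∈ S.verts
  · have hvC : v ∈ (compOf G S v).verts := ⟨hv, Relation.ReflTransGen.refl⟩
    rw [finsum_eq_single _ (compOf G S v), finsum_eq_if,
      if_pos (isCompOf_iff.2 ⟨v, hv, rfl⟩), tau, tau, if_pos hvC, if_pos hv]
    · refine finprod_congr fun e => finprod_congr_Prop (propext ?_) fun _ => rfl
      refine and_congr_right fun hs => not_congr ⟨fun h => h.1, fun h => ⟨h, ?_⟩⟩
      subst hs
      exact ⟨hvC, hdst e h, Relation.ReflTransGen.single ⟨e, h, rfl, rfl⟩⟩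
    · intro C hC
      rw [finsum_eq_if]
      split_ifs with hcomp
      · obtain ⟨w, -, rfl⟩ := isCompOf_iff.1 hcomp
        exact if_neg fun h => hC (compOf_eq_of_mem hbar h)
      · rfl
  · rw [tau, if_neg hv]
    refine finsum_eq_zero_of_forall_eq_zero fun C => ?_
    rw [finsum_eq_if]
    split_ifs with hcomp
    · obtain ⟨w, -, rfl⟩ := isCompOf_iff.1 hcomp
      exact if_neg fun h => hv h.1
    · rfl

end OT

open OT in
/-- for faces `A`, `B` with a minimal face `J = A∨B` containing both, all of
whose intersection components are faces, the rational Thom classes satisfy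
`τ_A · τ_B = τ_{A∨B} · Σ_C τ_C`, the sum over connected components `C` of `A ∩ B`. -/
theorem thom_class_product_relation
    {V E : Type} [Fintype V] [Fintype E] {n : ℕ} (hn : 1 ≤ n)
    (G : OTGraph V E) (hval : IsValent G n)
    (α : E → Fin n → ℚ) (hax : IsAxial G α)
    (θ : E → E → E) (hθ : IsConnection G α θ)
    (A B J : Subgr V E) (hA : IsFace G θ A) (hB : IsFace G θ B)
    (hJ : IsFace G θ J) (hAJ : Subgr.le A J) (hBJ : Subgr.le B J)
    (hmin : ∀ C : Subgr V E, IsFace G θ C → Subgr.le A C → Subgr.le B C → Subgr.le J C)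
    (hcomp : ∀ C : Subgr V E, IsCompOf G C (Subgr.inter A B) → IsFace G θ C) :
    ∀ v : V, tau G α A v * tau G α B v =
      tau G α J v *
        ∑ᶠ (C : Subgr V E) (_ : IsCompOf G C (Subgr.inter A B)), tau G α C v := by
  intro v
  rw [finsum_tau_comp α (S := Subgr.inter A B)
    (fun e he => ⟨hA.2.2.1 e he.1, hB.2.2.1 e he.2⟩)
    (fun e he => ⟨(hA.2.1 e he.1).2, (hB.2.1 e he.2).2⟩)]
  by_cases hvA : v ∈ A.verts
  swap
  · have hv : v ∉ (Subgr.inter A B).verts := fun h => hvA h.1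
    simp only [tau, if_neg hvA, if_neg hv, zero_mul, mul_zero]
  by_cases hvB : v ∈ B.verts
  swap
  · have hv : v ∉ (Subgr.inter A B).verts := fun h => hvB h.2
    simp only [tau, if_neg hvB, if_neg hv, mul_zero]
  have hv : v ∈ (Subgr.inter A B).verts := ⟨hvA, hvB⟩
  simp only [tau, if_pos hvA, if_pos hvB, if_pos (hAJ.1 hvA), if_pos hv, finprod_eq_if,
    finprod_eq_prod_of_fintype]
  rw [← Finset.prod_mul_distrib, ← Finset.prod_mul_distrib]
  refine Finset.prod_congr rfl fun e _ => ?_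
  by_cases hs : G.src e = v
  · subst hs
    have hJe := mem_edges_join_iff hax hθ hA hB hAJ hBJ hmin hvA hvB
    have hIe : e ∈ (Subgr.inter A B).edges ↔ e ∈ A.edges ∧ e ∈ B.edges := Iff.rfl
    by_cases heA : e ∈ A.edges <;> by_cases heB : e ∈ B.edges <;> simp [hJe, hIe, heA, heB]
  · simp [hs]
end
end

section
/- Let (Γ,α) be an orbifold torus graph admitting a connection, equipped with facet data (𝓕^{(1)}, λ) as described, and write λ(F_j) = (a_{1j}, …, a_{nj}) ∈ ℤ^n for j = 1, …, m. Then for each i = 1, …, n, the linear element Σ_{j=1}^m a_{ij}·x_{F_j} belongs to 𝒵_{Γ,α}; moreover μ(Σ_{j=1}^m a_{ij}·x_{F_j}) is the constant function sending every vertex of Γ to the linear form t_i. -/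
open scoped Classical

noncomputable section

namespace OT

/-- If exactly one outgoing edge at a vertex `v` of `S` lies outside `S`, the rational Thom class
of `S` at `v` is the linear form of that edge. -/
theorem tau_eq_linf {V E : Type} {n : ℕ} {G : OTGraph V E} {α : E → Fin n → ℚ} {S : Subgr V E}
    {v : V} {e : E} (hv : v ∈ S.verts) (he : ∀ e', G.src e' = v ∧ e' ∉ S.edges ↔ e' = e) :
    tau G α S v = linf (α e) := by
  simp only [tau, if_pos hv, he, finprod_cond_eq_left]

/-- If the covectors `a ℓ` are dual to the vectors `b ℓ`, every coordinate function `t_i` is the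
combination of the linear forms of the `a ℓ` with the `i`-th coordinates of the `b ℓ`. -/
theorem sum_C_mul_linf_eq_X {n : ℕ} {a b : Fin n → Fin n → ℚ}
    (h : ∀ ℓ j, ∑ i, a ℓ i * b j i = if ℓ = j then 1 else 0) (i : Fin n) :
    ∑ ℓ, MvPolynomial.C (b ℓ i) * linf (a ℓ) = MvPolynomial.X i := by
  have hab : Matrix.of a * (Matrix.of b).transpose = 1 := by
    ext ℓ j
    simpa [Matrix.mul_apply, Matrix.one_apply] using h ℓ j
  have hba (k : Fin n) : ∑ ℓ, b ℓ i * a ℓ k = if i = k then 1 else 0 := by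
    simpa [Matrix.mul_apply, Matrix.one_apply] using
      Matrix.ext_iff.mpr (mul_eq_one_comm.mp hab) i k
  simp only [linf, Finset.mul_sum, ← mul_assoc, ← map_mul]
  rw [Finset.sum_comm]
  simp only [← Finset.sum_mul, ← map_sum, hba]
  simp

theorem isIntPoly_X {σ : Type} (i : σ) : IsIntPoly (MvPolynomial.X i) := by
  intro d
  rw [MvPolynomial.coeff_X]
  split_ifs
  · exact ⟨1, by simp⟩
  · exact ⟨0, by simp⟩

end OT

open OT in
/-- for facet data `(𝓕^{(1)}, λ)` with `λ(F_j) = (a_{1j},…,a_{nj})`, each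
linear element `Σ_j a_{ij} x_{F_j}` lies in `𝒵_{Γ,α}`, and its image under `μ` is the
constant function with value the linear form `t_i`. -/
theorem linear_elements_of_weighted_face_ring
    {V E : Type} [Fintype V] [Fintype E] {n m : ℕ} (hn : 1 ≤ n) (hm : 1 ≤ m)
    (G : OTGraph V E) (hval : IsValent G n)
    (α : E → Fin n → ℚ) (hax : IsAxial G α)
    (θ : E → E → E) (hθ : IsConnection G α θ)
    (facets : Fin m → Subgr V E)
    (hface : ∀ j, IsFace G θ (facets j))
    (hfdim : ∀ j, ∀ v ∈ (facets j).verts,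
      Nat.card {e : E // e ∈ (facets j).edges ∧ G.src e = v} = n - 1)
    (K : V → Fin n → Fin m) (Evec : V → Fin n → E)
    (hKinj : ∀ v : V, Function.Injective (K v))
    (hKmem : ∀ (v : V) (ℓ : Fin n), v ∈ (facets (K v ℓ)).verts)
    (hKall : ∀ (v : V) (j : Fin m), v ∈ (facets j).verts → ∃ ℓ, K v ℓ = j)
    (hEsrc : ∀ (v : V) (ℓ : Fin n), G.src (Evec v ℓ) = v)
    (hEinj : ∀ v : V, Function.Injective (Evec v))
    (hEall : ∀ (v : V) (e : E), G.src e = v → ∃ ℓ, Evec v ℓ = e)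
    (hEmem : ∀ (v : V) (ℓ j : Fin n), Evec v ℓ ∈ (facets (K v j)).edges ↔ j ≠ ℓ)
    (lam : Fin m → Fin n → ℤ)
    (hdual : ∀ (v : V) (ℓ j : Fin n),
      ∑ i, α (Evec v ℓ) i * (lam (K v j) i : ℚ) = if ℓ = j then 1 else 0) :
    ∀ i : Fin n,
      (∀ v : V, IsIntPoly (∑ j, MvPolynomial.C ((lam j i : ℤ) : ℚ) * tau G α (facets j) v)) ∧
      (∀ v : V, (∑ j, MvPolynomial.C ((lam j i : ℤ) : ℚ) * tau G α (facets j) v) =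
        MvPolynomial.X i) := by
  intro i
  have key (v : V) : (∑ j, MvPolynomial.C ((lam j i : ℤ) : ℚ) * tau G α (facets j) v) =
      MvPolynomial.X i := by
    have htau (ℓ : Fin n) : tau G α (facets (K v ℓ)) v = linf (α (Evec v ℓ)) := by
      refine tau_eq_linf (hKmem v ℓ) fun e => ⟨?_, ?_⟩
      · rintro ⟨hsrc, hnot⟩
        obtain ⟨k, rfl⟩ := hEall v e hsrc
        rw [hEmem, not_not] at hnot
        rw [hnot]
      · rintro rfl
        exact ⟨hEsrc v ℓ, fun h => (hEmem v ℓ ℓ).mp h rfl⟩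
    rw [← sum_C_mul_linf_eq_X (hdual v) i]
    symm
    refine Finset.sum_of_injOn (K v) (hKinj v).injOn (by simp) (fun j _ hj => ?_)
      (fun ℓ _ => by rw [htau])
    have hv : v ∉ (facets j).verts := fun h => by
      obtain ⟨ℓ, rfl⟩ := hKall v j h
      exact hj ⟨ℓ, by simp, rfl⟩
    simp [tau, hv]
  exact ⟨fun v => (key v).symm ▸ isIntPoly_X i, key⟩
end
end
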